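/- For every z ∈ ℂ \ {0}, the bilateral sum of squares ∑_{n=−∞}^{∞} φ_n(z)² converges and equals 4 · ((q²;q²)_∞² / (q;q²)_∞²) · θ_{q²}(−z²). -/

import Mathlib

open Complex Filter Topology

/-- Finite q-Pochhammer symbol `(a;q)_n`. -/
noncomputable def qp (q a : ℂ) (n : ℕ) : ℂ := ∏ k ∈ Finset.range n, (1 - a * q ^ k)

/-- Infinite q-Pochhammer symbol `(a;q)_∞`. -/
noncomputable def qpInf (q a : ℂ) : ℂ := ∏' k : ℕ, (1 - a * q ^ k)

/-- Theta function `θ_q(x) = (x;q)_∞ (q/x;q)_∞`. -/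
noncomputable def theta (q x : ℂ) : ℂ := qpInf q x * qpInf q (q / x)

/-- The square-summable solution φ_n(x). -/
noncomputable def phi (q : ℝ) (x : ℂ) (n : ℤ) : ℂ :=
  qpInf (q : ℂ) (-1) * x ^ n * (q : ℂ) ^ (n * (n - 1) / 2) *
    ∑' k : ℕ, (q : ℂ) ^ (2 * (k * (k - 1))) *
      (-((q : ℂ) ^ (-2 * n + 4)) * x ^ (-2 : ℤ)) ^ k /
        qp ((q : ℂ) ^ 2) ((q : ℂ) ^ 2) k

section QPochhammer

variable {p : ℂ}

lemma summable_norm_mul_pow (hp : ‖p‖ < 1) (a : ℂ) : Summable fun k : ℕ => ‖-(a * p ^ k)‖ := by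
  simpa [norm_mul, norm_pow] using
    (summable_geometric_of_lt_one (norm_nonneg p) hp).mul_left ‖a‖

lemma multipliable_qpInf (hp : ‖p‖ < 1) (a : ℂ) : Multipliable fun k : ℕ => 1 - a * p ^ k := by
  simpa [sub_eq_add_neg] using multipliable_one_add_of_summable (summable_norm_mul_pow hp a)

lemma qpInf_eq_qp_mul (hp : ‖p‖ < 1) (a : ℂ) (n : ℕ) :
    qpInf p a = qp p a n * qpInf p (a * p ^ n) := by
  have h : (fun k : ℕ => 1 - a * p ^ (k + n)) = fun k : ℕ => 1 - a * p ^ n * p ^ k := by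
    funext k; ring
  have hm : Multipliable fun k : ℕ => 1 - a * p ^ (k + n) := by
    rw [h]; exact multipliable_qpInf hp _
  rw [qpInf, qp, ← Multipliable.prod_mul_tprod_nat_mul' (f := fun k : ℕ => 1 - a * p ^ k) hm, h]
  rfl

lemma qpInf_eq_one_sub_mul (hp : ‖p‖ < 1) (a : ℂ) :
    qpInf p a = (1 - a) * qpInf p (a * p) := by
  simpa [qp] using qpInf_eq_qp_mul hp a 1

lemma qpInf_eq_zero {a : ℂ} (h : ∃ k : ℕ, a * p ^ k = 1) : qpInf p a = 0 := by
  obtain ⟨k, hk⟩ := h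
  exact tprod_of_exists_eq_zero ⟨k, by simp [hk]⟩

lemma one_sub_pow_succ_ne_zero (hp : ‖p‖ < 1) (k : ℕ) : 1 - p ^ (k + 1) ≠ 0 := by
  intro h
  have h1 : ‖p‖ ^ (k + 1) = 1 := by
    rw [← norm_pow, ← sub_eq_zero.mp h, norm_one]
  exact (pow_lt_one₀ (norm_nonneg p) hp k.succ_ne_zero).ne h1

lemma qpInf_self_ne_zero (hp : ‖p‖ < 1) : qpInf p p ≠ 0 := by
  have := tprod_one_add_ne_zero_of_summable (f := fun k : ℕ => -(p * p ^ k))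
    (fun k => by
      have := one_sub_pow_succ_ne_zero hp k
      rwa [pow_succ', sub_eq_add_neg] at this) (summable_norm_mul_pow hp p)
  simpa [qpInf, sub_eq_add_neg] using this

lemma qp_succ (a : ℂ) (n : ℕ) : qp p a (n + 1) = qp p a n * (1 - a * p ^ n) :=
  Finset.prod_range_succ _ _

lemma qp_self_ne_zero (hp : ‖p‖ < 1) (n : ℕ) : qp p p n ≠ 0 :=
  Finset.prod_ne_zero_iff.mpr fun k _ => by
    rw [← pow_succ']; exact one_sub_pow_succ_ne_zero hp k

lemma tendsto_qp (hp : ‖p‖ < 1) (a : ℂ) : Tendsto (qp p a) atTop (𝓝 (qpInf p a)) :=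
  (multipliable_qpInf hp a).tendsto_prod_tprod_nat

/-- Euler's product `(-q;q)_∞ (q;q²)_∞ = 1`. -/
lemma qpInf_neg_self_mul_qpInf_sq (hp : ‖p‖ < 1) : qpInf p (-p) * qpInf (p ^ 2) p = 1 := by
  have hp2 : ‖p ^ 2‖ < 1 := by
    rw [norm_pow]; exact pow_lt_one₀ (norm_nonneg p) hp two_ne_zero
  have he : (fun k : ℕ => 1 - p * p ^ (2 * k)) = fun k : ℕ => 1 - p * (p ^ 2) ^ k := by
    funext k; ring
  have ho : (fun k : ℕ => 1 - p * p ^ (2 * k + 1)) = fun k : ℕ => 1 - p ^ 2 * (p ^ 2) ^ k := by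
    funext k; ring
  have h1 : qpInf (p ^ 2) p * qpInf (p ^ 2) (p ^ 2) = qpInf p p := by
    have := tprod_even_mul_odd (f := fun k : ℕ => 1 - p * p ^ k)
      (by rw [he]; exact multipliable_qpInf hp2 _) (by rw [ho]; exact multipliable_qpInf hp2 _)
    rwa [he, ho] at this
  have h2 : qpInf p p * qpInf p (-p) = qpInf (p ^ 2) (p ^ 2) := by
    rw [qpInf, qpInf, ← (multipliable_qpInf hp p).tprod_mul (multipliable_qpInf hp (-p)), qpInf]
    exact tprod_congr fun k => by ring
  apply mul_right_cancel₀ (qpInf_self_ne_zero hp2)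
  linear_combination h2 + qpInf p (-p) * h1

lemma qpInf_neg_one (hp : ‖p‖ < 1) : qpInf p (-1) = 2 / qpInf (p ^ 2) p := by
  have h := qpInf_neg_self_mul_qpInf_sq hp
  have h0 : qpInf (p ^ 2) p ≠ 0 := right_ne_zero_of_mul_eq_one h
  rw [qpInf_eq_one_sub_mul hp, eq_div_iff h0]
  simp only [neg_mul, one_mul]
  linear_combination 2 * h

lemma tendsto_tsum_mul_pow_pow (hp : ‖p‖ < 1) {c : ℕ → ℂ} (hc : Summable c) :
    Tendsto (fun n : ℕ => ∑' j, c j * (p ^ n) ^ j) atTop (𝓝 (c 0)) := by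
  have h0 : ∑' j, c j * (0 : ℂ) ^ j = c 0 := by
    rw [tsum_eq_single 0 fun j hj => by simp [hj]]; simp
  rw [← h0]
  refine tendsto_tsum_of_dominated_convergence hc.norm (fun j => ?_) (.of_forall fun n j => ?_)
  · exact ((tendsto_pow_atTop_nhds_zero_of_norm_lt_one hp).pow j).const_mul _
  · rw [norm_mul, norm_pow, norm_pow]
    exact mul_le_of_le_one_right (norm_nonneg _)
      (pow_le_one₀ (by positivity) (pow_le_one₀ (norm_nonneg p) hp.le))

lemma summable_mul_pow_pow (hp : ‖p‖ < 1) {c : ℕ → ℂ} (hc : Summable c) (n : ℕ) :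
    Summable fun j => c j * (p ^ n) ^ j := by
  refine .of_norm_bounded hc.norm fun j => ?_
  rw [norm_mul, norm_pow, norm_pow]
  exact mul_le_of_le_one_right (norm_nonneg _)
    (pow_le_one₀ (by positivity) (pow_le_one₀ (norm_nonneg p) hp.le))

lemma tsum_sub_tsum_mul_pow (hp : ‖p‖ < 1) {c : ℕ → ℂ} (hc : Summable c) (n : ℕ) :
    ∑' j, c j * (p ^ n) ^ j - ∑' j, c j * (p ^ (n + 1)) ^ j =
      ∑' j, c (j + 1) * (1 - p ^ (j + 1)) * (p ^ n) ^ (j + 1) := by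
  have h1 := summable_mul_pow_pow hp hc n
  have h2 := summable_mul_pow_pow hp hc (n + 1)
  rw [← h1.tsum_sub h2, (h1.sub h2).tsum_eq_zero_add]
  simp only [pow_zero, sub_self, zero_add]
  exact tsum_congr fun j => by ring

lemma tendsto_one_sub_mul_pow (hp : ‖p‖ < 1) : Tendsto (fun n : ℕ => 1 - p * p ^ n) atTop (𝓝 1) := by
  simpa using ((tendsto_pow_atTop_nhds_zero_of_norm_lt_one hp).const_mul p).const_sub 1

lemma summable_pow_div_qp (hp : ‖p‖ < 1) {w : ℂ} (hw0 : w ≠ 0) (hw : ‖w‖ < 1) :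
    Summable fun j : ℕ => w ^ j / qp p p j := by
  refine summable_of_ratio_test_tendsto_lt_one hw
    (.of_forall fun j => div_ne_zero (pow_ne_zero _ hw0) (qp_self_ne_zero hp j)) ?_
  have h : Tendsto (fun n : ℕ => ‖w / (1 - p * p ^ n)‖) atTop (𝓝 ‖w / 1‖) :=
    (tendsto_const_nhds.div (tendsto_one_sub_mul_pow hp) one_ne_zero).norm
  rw [div_one] at h
  refine h.congr fun j => ?_
  have h1 := qp_self_ne_zero hp j
  have h2 := qp_self_ne_zero hp (j + 1)
  rw [← norm_div]
  congr 1
  rw [qp_succ] at h2 ⊢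
  have h3 := right_ne_zero_of_mul h2
  field_simp
  ring

/-- Euler's expansion of `1 / (w;p)_∞`. -/
lemma qpInf_mul_tsum_pow_div_qp (hp : ‖p‖ < 1) {w : ℂ} (hw0 : w ≠ 0) (hw : ‖w‖ < 1) :
    qpInf p w * ∑' j : ℕ, w ^ j / qp p p j = 1 := by
  set c : ℕ → ℂ := fun j => w ^ j / qp p p j with hc_def
  have hc : Summable c := summable_pow_div_qp hp hw0 hw
  have hrec (j : ℕ) : c (j + 1) * (1 - p ^ (j + 1)) = w * c j := by
    have h1 := qp_self_ne_zero hp j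
    have h3 := one_sub_pow_succ_ne_zero hp j
    simp only [hc_def, qp_succ, ← pow_succ' p]
    field_simp
    ring
  have hstep (n : ℕ) : (1 - w * p ^ n) * ∑' j, c j * (p ^ n) ^ j =
      ∑' j, c j * (p ^ (n + 1)) ^ j := by
    have h : ∑' j, c (j + 1) * (1 - p ^ (j + 1)) * (p ^ n) ^ (j + 1) =
        w * p ^ n * ∑' j, c j * (p ^ n) ^ j := by
      rw [← tsum_mul_left]
      exact tsum_congr fun j => by rw [hrec]; ring
    linear_combination tsum_sub_tsum_mul_pow hp hc n + h
  have hn (n : ℕ) : qp p w n * ∑' j, c j = ∑' j, c j * (p ^ n) ^ j := by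
    induction n with
    | zero => simp [qp]
    | succ n ih => rw [qp_succ, ← hstep, ← ih]; ring
  have hlim := (tendsto_qp hp w).mul_const (∑' j, c j)
  simp only [hn] at hlim
  simpa [hc_def, qp] using tendsto_nhds_unique hlim (tendsto_tsum_mul_pow_pow hp hc)

end QPochhammer

section Gauss

/-- The general term `p^{s(s-1)/2} y^s` of a theta series. -/
noncomputable def gaussTerm (p y : ℂ) (s : ℤ) : ℂ := p ^ (s * (s - 1) / 2) * y ^ s

variable {p y : ℂ}

lemma int_triangle_add (a b : ℤ) :
    (a + b) * (a + b - 1) / 2 = a * (a - 1) / 2 + b * (b - 1) / 2 + a * b := by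
  obtain ⟨m, hm⟩ := even_iff_two_dvd.mp (Int.even_mul_pred_self a)
  obtain ⟨n, hn⟩ := even_iff_two_dvd.mp (Int.even_mul_pred_self b)
  have : (a + b) * (a + b - 1) = 2 * (m + n + a * b) := by linear_combination hm + hn
  rw [this, hm, hn]
  simp

lemma gaussTerm_add (hp0 : p ≠ 0) (hy : y ≠ 0) (a b : ℤ) :
    gaussTerm p y (a + b) = gaussTerm p y a * gaussTerm p y b * p ^ (a * b) := by
  simp only [gaussTerm]
  rw [int_triangle_add, zpow_add₀ hp0, zpow_add₀ hp0, zpow_add₀ hy]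
  ring

lemma gaussTerm_zero : gaussTerm p y 0 = 1 := by simp [gaussTerm]

lemma gaussTerm_one : gaussTerm p y 1 = y := by simp [gaussTerm]

lemma gaussTerm_ne_zero (hp0 : p ≠ 0) (hy : y ≠ 0) (s : ℤ) : gaussTerm p y s ≠ 0 :=
  mul_ne_zero (zpow_ne_zero _ hp0) (zpow_ne_zero _ hy)

lemma gaussTerm_mul (c : ℂ) (s : ℤ) : gaussTerm p (c * y) s = c ^ s * gaussTerm p y s := by
  simp only [gaussTerm, mul_zpow]; ring

lemma gaussTerm_succ (hp0 : p ≠ 0) (hy : y ≠ 0) (s : ℤ) :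
    gaussTerm p y (s + 1) = gaussTerm p y s * (y * p ^ s) := by
  rw [gaussTerm_add hp0 hy, gaussTerm_one, mul_one, mul_assoc]

lemma gaussTerm_neg (hp0 : p ≠ 0) (s : ℤ) : gaussTerm p y (-s) = gaussTerm p (p / y) s := by
  have h : -s * (-s - 1) / 2 = s * (s - 1) / 2 + s := by
    obtain ⟨m, hm⟩ := even_iff_two_dvd.mp (Int.even_mul_pred_self s)
    have : -s * (-s - 1) = 2 * (m + s) := by linear_combination hm
    rw [this, hm]
    simp
  simp only [gaussTerm]
  rw [h, zpow_add₀ hp0, div_zpow, zpow_neg]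
  ring

lemma summable_gaussTerm_nat (hp0 : p ≠ 0) (hp : ‖p‖ < 1) (hy : y ≠ 0) :
    Summable fun n : ℕ => gaussTerm p y n := by
  refine summable_of_ratio_test_tendsto_lt_one zero_lt_one
    (.of_forall fun n => gaussTerm_ne_zero hp0 hy n) ?_
  have h := ((tendsto_pow_atTop_nhds_zero_of_norm_lt_one hp).const_mul y).norm
  rw [mul_zero, norm_zero] at h
  refine h.congr fun n => ?_
  push_cast
  rw [gaussTerm_succ hp0 hy, ← norm_div, mul_div_cancel_left₀ _ (gaussTerm_ne_zero hp0 hy n),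
    zpow_natCast]

lemma summable_gaussTerm (hp0 : p ≠ 0) (hp : ‖p‖ < 1) (hy : y ≠ 0) :
    Summable (gaussTerm p y) := by
  refine .of_nat_of_neg (summable_gaussTerm_nat hp0 hp hy) ?_
  simp only [gaussTerm_neg hp0]
  exact summable_gaussTerm_nat hp0 hp (div_ne_zero hp0 hy)

lemma summable_gaussTerm_div_qp (hp0 : p ≠ 0) (hp : ‖p‖ < 1) (hy : y ≠ 0) :
    Summable fun n : ℕ => gaussTerm p y n / qp p p n := by
  refine summable_of_ratio_test_tendsto_lt_one zero_lt_one
    (.of_forall fun n => div_ne_zero (gaussTerm_ne_zero hp0 hy n) (qp_self_ne_zero hp n)) ?_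
  have h := (((tendsto_pow_atTop_nhds_zero_of_norm_lt_one hp).const_mul y).div
    (tendsto_one_sub_mul_pow hp) one_ne_zero).norm
  rw [mul_zero, zero_div, norm_zero] at h
  refine h.congr fun n => ?_
  have h1 := qp_self_ne_zero hp n
  have h2 := qp_self_ne_zero hp (n + 1)
  have h4 := gaussTerm_ne_zero hp0 hy n
  push_cast
  rw [gaussTerm_succ hp0 hy, ← norm_div, zpow_natCast]
  congr 1
  rw [qp_succ] at h2 ⊢
  have h3 := right_ne_zero_of_mul h2
  simp only [Pi.div_apply]
  field_simp

/-- Euler's expansion of `(-y;p)_∞`. -/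
lemma tsum_gaussTerm_div_qp (hp0 : p ≠ 0) (hp : ‖p‖ < 1) (hy : y ≠ 0) :
    ∑' n : ℕ, gaussTerm p y n / qp p p n = qpInf p (-y) := by
  set c : ℕ → ℂ := fun n => gaussTerm p y n / qp p p n with hc_def
  have hc : Summable c := summable_gaussTerm_div_qp hp0 hp hy
  have hrec (j : ℕ) : c (j + 1) * (1 - p ^ (j + 1)) = y * p ^ j * c j := by
    have h1 := qp_self_ne_zero hp j
    have h3 := one_sub_pow_succ_ne_zero hp j
    simp only [hc_def, qp_succ, ← pow_succ' p]
    push_cast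
    rw [gaussTerm_succ hp0 hy, zpow_natCast]
    field_simp
  have hstep (n : ℕ) : ∑' j, c j * (p ^ n) ^ j =
      (1 - -y * p ^ n) * ∑' j, c j * (p ^ (n + 1)) ^ j := by
    have h : ∑' j, c (j + 1) * (1 - p ^ (j + 1)) * (p ^ n) ^ (j + 1) =
        y * p ^ n * ∑' j, c j * (p ^ (n + 1)) ^ j := by
      rw [← tsum_mul_left]
      exact tsum_congr fun j => by rw [hrec]; ring
    linear_combination tsum_sub_tsum_mul_pow hp hc n + h
  have hn (n : ℕ) : ∑' j, c j = qp p (-y) n * ∑' j, c j * (p ^ n) ^ j := by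
    induction n with
    | zero => simp [qp]
    | succ n ih => rw [qp_succ, ih, hstep]; ring
  have hlim := (tendsto_qp hp (-y)).mul (tendsto_tsum_mul_pow_pow hp hc)
  simp only [← hn] at hlim
  simpa [hc_def, qp, gaussTerm_zero] using tendsto_nhds_unique tendsto_const_nhds hlim

end Gauss

section JacobiTripleProduct

variable {p y : ℂ}

/-- The terms with negative index vanish, and Euler's expansion sums the others. -/
lemma tsum_gaussTerm_mul_qpInf (hp0 : p ≠ 0) (hp : ‖p‖ < 1) (hy : y ≠ 0) :
    ∑' s : ℤ, gaussTerm p y s * qpInf p (p ^ (s + 1)) = qpInf p p * qpInf p (-y) := by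
  rw [← Nat.cast_injective.tsum_eq (f := fun s : ℤ => gaussTerm p y s * qpInf p (p ^ (s + 1)))]
  · rw [← tsum_gaussTerm_div_qp hp0 hp hy, ← tsum_mul_left]
    refine tsum_congr fun n => ?_
    have h1 := qp_self_ne_zero hp n
    have h2 : p ^ ((n : ℤ) + 1) = p * p ^ n := by
      rw [zpow_add_one₀ hp0, zpow_natCast, mul_comm]
    rw [h2, qpInf_eq_qp_mul hp p n]
    field_simp
  · intro s hs
    by_contra hneg
    have hs0 : s < 0 := by
      by_contra h
      exact hneg ⟨s.toNat, by simpa using h⟩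
    refine hs ?_
    have : qpInf p (p ^ (s + 1)) = 0 := qpInf_eq_zero ⟨(-(s + 1)).toNat, by
      rw [← zpow_natCast, ← zpow_add₀ hp0, Int.toNat_of_nonneg (by omega)]; simp⟩
    simp [this]

/-- The shear `(s, k) ↦ (s + k, k)` of `ℤ × ℕ`. -/
def intNatShear : ℤ × ℕ ≃ ℤ × ℕ where
  toFun x := (x.1 + x.2, x.2)
  invFun x := (x.1 - x.2, x.2)
  left_inv x := by simp
  right_inv x := by simp

lemma jacobi_triple_product_of_norm_lt (hp0 : p ≠ 0) (hp : ‖p‖ < 1) (hy : y ≠ 0)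
    (hpy : ‖p‖ < ‖y‖) :
    ∑' s : ℤ, gaussTerm p y s = qpInf p p * qpInf p (-y) * qpInf p (-(p / y)) := by
  have hw0 : -(p / y) ≠ 0 := neg_ne_zero.mpr (div_ne_zero hp0 hy)
  have hw : ‖-(p / y)‖ < 1 := by
    rw [norm_neg, norm_div, div_lt_one (norm_pos_iff.mpr hy)]; exact hpy
  have hG := summable_gaussTerm hp0 hp hy
  have he := summable_pow_div_qp hp hw0 hw
  obtain ⟨F, hF_def⟩ : ∃ F : ℤ × ℕ → ℂ,
      F = fun x => gaussTerm p y x.1 * ((-(p / y)) ^ x.2 / qp p p x.2) := ⟨_, rfl⟩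
  have hF : Summable F := by
    rw [hF_def]
    exact summable_mul_of_summable_norm (f := gaussTerm p y)
      (g := fun k : ℕ => (-(p / y)) ^ k / qp p p k) hG.norm he.norm
  have hterm (s : ℤ) (k : ℕ) : F (intNatShear (s, k)) =
      gaussTerm p y s * (gaussTerm p (-p ^ (s + 1)) k / qp p p k) := by
    simp only [hF_def, intNatShear, Equiv.coe_fn_mk]
    rw [gaussTerm_add hp0 hy]
    have : -p ^ (s + 1) = (-(p / y) * p ^ s) * y := by
      rw [zpow_add_one₀ hp0]; field_simp
    rw [this, gaussTerm_mul, mul_zpow, zpow_natCast, zpow_mul, zpow_natCast]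
    ring
  have hsum : (∑' s : ℤ, gaussTerm p y s) * ∑' k : ℕ, (-(p / y)) ^ k / qp p p k =
      qpInf p p * qpInf p (-y) := by
    rw [tsum_mul_tsum_of_summable_norm hG.norm he.norm, ← tsum_gaussTerm_mul_qpInf hp0 hp hy,
      ← hF_def, ← intNatShear.tsum_eq F, (show Summable fun x => F (intNatShear x) from
      intNatShear.summable_iff.mpr hF).tsum_prod]
    refine tsum_congr fun s => ?_
    simp only [hterm]
    rw [tsum_mul_left,
      tsum_gaussTerm_div_qp hp0 hp (neg_ne_zero.mpr (zpow_ne_zero _ hp0)), neg_neg]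
  rw [← hsum, mul_assoc, mul_comm (tsum _) (qpInf p _), qpInf_mul_tsum_pow_div_qp hp hw0 hw,
    mul_one]

/-- The Jacobi triple product identity. -/
lemma jacobi_triple_product (hp0 : p ≠ 0) (hp : ‖p‖ < 1) (hy : y ≠ 0) :
    ∑' s : ℤ, gaussTerm p y s = qpInf p p * qpInf p (-y) * qpInf p (-(p / y)) := by
  obtain ⟨N, hN⟩ := exists_pow_lt_of_lt_one (norm_pos_iff.mpr hy) hp
  replace hN : ‖p‖ ^ (N + 1) < ‖y‖ :=
    (pow_le_pow_of_le_one (norm_nonneg p) hp.le N.le_succ).trans_lt hN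
  induction N generalizing y with
  | zero => exact jacobi_triple_product_of_norm_lt hp0 hp hy (by simpa using hN)
  | succ N ih =>
    have hx : y / p ≠ 0 := div_ne_zero hy hp0
    have h := ih hx (by
      rw [norm_div, lt_div_iff₀ (norm_pos_iff.mpr hp0)]
      simpa [pow_succ] using hN)
    have hG : ∑' s : ℤ, gaussTerm p (y / p) s = y / p * ∑' s : ℤ, gaussTerm p y s := by
      rw [← (Equiv.addRight (1 : ℤ)).tsum_eq, ← tsum_mul_left]
      refine tsum_congr fun s => ?_
      have hy' : y = p * (y / p) := by field_simp
      rw [Equiv.coe_addRight, gaussTerm_succ hp0 hx]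
      conv_rhs => rw [hy', gaussTerm_mul, ← hy']
      ring
    have h1 := qpInf_eq_one_sub_mul hp (-(y / p))
    have h2 := qpInf_eq_one_sub_mul hp (-(p / y))
    have e1 : -(y / p) * p = -y := by field_simp
    have e2 : -(p / (y / p)) = -(p / y) * p := by field_simp
    rw [e1] at h1
    rw [hG, h1, e2] at h
    apply mul_left_cancel₀ hx
    rw [h, h2]
    field_simp
    ring

end JacobiTripleProduct

section SumOfSquares

variable {q : ℂ}

/-- Coefficients of the expansion of `1 / (-qt;q²)_∞` in powers of `t`. -/
noncomputable def airyCoeff (q : ℂ) (k : ℕ) : ℂ := (-q) ^ k / qp (q ^ 2) (q ^ 2) k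

lemma norm_sq_lt_one (hq : ‖q‖ < 1) : ‖q ^ 2‖ < 1 := by
  rw [norm_pow]; exact pow_lt_one₀ (norm_nonneg q) hq two_ne_zero

lemma summable_airyCoeff (hq0 : q ≠ 0) (hq : ‖q‖ < 1) : Summable (airyCoeff q) :=
  summable_pow_div_qp (norm_sq_lt_one hq) (neg_ne_zero.mpr hq0) (by rwa [norm_neg])

/-- Double-sum kernel obtained by collecting the terms of the sum of squares. -/
noncomputable def airyKernel (q : ℂ) (x : ℕ × ℕ) : ℂ :=
  airyCoeff q x.1 * airyCoeff q x.2 * q ^ (((x.1 : ℤ) - x.2) ^ 2)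

lemma summable_airyKernel (hq0 : q ≠ 0) (hq : ‖q‖ < 1) : Summable (airyKernel q) := by
  have h := summable_airyCoeff hq0 hq
  refine .of_norm_bounded (summable_mul_of_summable_norm h.norm h.norm).norm fun x => ?_
  rw [airyKernel, norm_mul]
  refine mul_le_of_le_one_right (norm_nonneg _) ?_
  obtain ⟨n, hn⟩ := Int.eq_ofNat_of_zero_le (sq_nonneg ((x.1 : ℤ) - x.2))
  rw [hn, zpow_natCast, norm_pow]
  exact pow_le_one₀ (norm_nonneg q) hq.le

lemma airyKernel_eq (hq0 : q ≠ 0) (k j : ℕ) :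
    airyKernel q (k, j) = airyCoeff q k * q ^ (k ^ 2) *
      (gaussTerm (q ^ 2) (-(q ^ 2) ^ (1 - (k : ℤ))) j / qp (q ^ 2) (q ^ 2) j) := by
  have hj : ((k : ℤ) - j) ^ 2 = k ^ 2 + 2 * (j * (j - 1) / 2) + (1 - 2 * k) * j := by
    rw [Int.mul_ediv_cancel' (even_iff_two_dvd.mp (Int.even_mul_pred_self _))]; ring
  have h1 : -(q ^ 2) ^ (1 - (k : ℤ)) = (-q) * q ^ (1 - 2 * (k : ℤ)) := by
    rw [neg_mul, ← zpow_one_add₀ hq0, ← zpow_natCast q 2, ← zpow_mul]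
    congr 2; push_cast; ring
  simp only [airyKernel, airyCoeff, gaussTerm]
  rw [hj, h1, zpow_add₀ hq0, zpow_add₀ hq0, mul_zpow, zpow_mul, zpow_mul, ← zpow_natCast q (k ^ 2)]
  push_cast
  simp only [zpow_natCast, zpow_ofNat]
  ring

lemma tsum_airyKernel (hq0 : q ≠ 0) (hq : ‖q‖ < 1) :
    ∑' x, airyKernel q x = qpInf (q ^ 2) (q ^ 2) := by
  have hp := norm_sq_lt_one hq
  have hp0 : q ^ 2 ≠ 0 := pow_ne_zero 2 hq0
  rw [(summable_airyKernel hq0 hq).tsum_prod]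
  simp only [airyKernel_eq hq0]
  simp_rw [tsum_mul_left,
    tsum_gaussTerm_div_qp hp0 hp (neg_ne_zero.mpr (zpow_ne_zero _ hp0)), neg_neg]
  rw [tsum_eq_single 0]
  · simp [airyCoeff, qp]
  · intro k hk
    have : qpInf (q ^ 2) ((q ^ 2) ^ (1 - (k : ℤ))) = 0 := qpInf_eq_zero ⟨k - 1, by
      rw [← zpow_natCast (q ^ 2) (k - 1), ← zpow_add₀ hp0]
      have : (1 - (k : ℤ)) + ((k - 1 : ℕ) : ℤ) = 0 := by omega
      rw [this, zpow_zero]⟩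
    rw [this, mul_zero]

variable {z : ℂ}

lemma gaussTerm_mul_gaussTerm (hq0 : q ≠ 0) (hz : z ≠ 0) (s d : ℤ) :
    gaussTerm q z (s + d) * gaussTerm q z (s - d) =
      gaussTerm (q ^ 2) (z ^ 2) s * q ^ (d ^ 2) := by
  have h : (s + d) * (s + d - 1) / 2 + (s - d) * (s - d - 1) / 2 =
      2 * (s * (s - 1) / 2) + d ^ 2 := by
    obtain ⟨a, ha⟩ := even_iff_two_dvd.mp (Int.even_mul_pred_self (s + d))
    obtain ⟨b, hb⟩ := even_iff_two_dvd.mp (Int.even_mul_pred_self (s - d))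
    obtain ⟨c, hc⟩ := even_iff_two_dvd.mp (Int.even_mul_pred_self s)
    have h2 : 2 * (a + b) = 2 * (2 * c + d ^ 2) := by linear_combination 2 * hc - ha - hb
    rw [ha, hb, hc]
    simp only [Int.mul_ediv_cancel_left _ (two_ne_zero : (2 : ℤ) ≠ 0)]
    linarith
  have e : q ^ ((s + d) * (s + d - 1) / 2) * q ^ ((s - d) * (s - d - 1) / 2) =
      (q ^ 2) ^ (s * (s - 1) / 2) * q ^ (d ^ 2) := by
    rw [← zpow_add₀ hq0, h, zpow_add₀ hq0, zpow_mul, zpow_ofNat]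
  have e' : z ^ (s + d) * z ^ (s - d) = (z ^ 2) ^ s := by
    rw [← zpow_add₀ hz, show s + d + (s - d) = 2 * s by ring, zpow_mul, zpow_ofNat]
  simp only [gaussTerm]
  linear_combination z ^ (s + d) * z ^ (s - d) * e +
    (q ^ 2) ^ (s * (s - 1) / 2) * q ^ (d ^ 2) * e'

lemma summable_airyCoeff_mul_gaussTerm (hq0 : q ≠ 0) (hq : ‖q‖ < 1) (hz : z ≠ 0) (n : ℤ) :
    Summable fun k : ℕ => airyCoeff q k * gaussTerm q z (n - 2 * k) := by
  have hg : Summable fun k : ℕ => gaussTerm q z (n - 2 * k) :=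
    (summable_gaussTerm hq0 hq hz).comp_injective fun a b h => by
      simpa using h
  have h := summable_mul_of_summable_norm (summable_airyCoeff hq0 hq).norm hg.norm
  exact h.comp_injective (i := fun k : ℕ => (k, k)) fun a b h => (Prod.mk.inj h).1

/-- Sum of squares of the convolution of the Gauss terms with `airyCoeff`. -/
lemma hasSum_sq_tsum_airyCoeff_mul_gaussTerm (hq0 : q ≠ 0) (hq : ‖q‖ < 1) (hz : z ≠ 0) :
    HasSum (fun n : ℤ => (∑' k : ℕ, airyCoeff q k * gaussTerm q z (n - 2 * k)) ^ 2)
      ((∑' s : ℤ, gaussTerm (q ^ 2) (z ^ 2) s) * qpInf (q ^ 2) (q ^ 2)) := by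
  have hG := summable_gaussTerm (pow_ne_zero 2 hq0) (norm_sq_lt_one hq) (pow_ne_zero 2 hz)
  have hK := summable_airyKernel hq0 hq
  let shift : ℤ × (ℕ × ℕ) ≃ ℤ × (ℕ × ℕ) :=
    { toFun := fun x => (x.1 - x.2.1 - x.2.2, x.2)
      invFun := fun x => (x.1 + x.2.2 + x.2.1, x.2)
      left_inv := fun x => by simp
      right_inv := fun x => by simp }
  have hsum : HasSum (fun x : ℤ × (ℕ × ℕ) => gaussTerm (q ^ 2) (z ^ 2) x.1 * airyKernel q x.2)
      ((∑' s : ℤ, gaussTerm (q ^ 2) (z ^ 2) s) * qpInf (q ^ 2) (q ^ 2)) := by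
    rw [← tsum_airyKernel hq0 hq, tsum_mul_tsum_of_summable_norm hG.norm hK.norm]
    exact (summable_mul_of_summable_norm hG.norm hK.norm).hasSum
  refine ((shift.hasSum_iff).mpr hsum).prod_fiberwise fun n => ?_
  have hn := summable_airyCoeff_mul_gaussTerm hq0 hq hz n
  have hterm (x : ℕ × ℕ) :
      airyCoeff q x.1 * gaussTerm q z (n - 2 * x.1) *
        (airyCoeff q x.2 * gaussTerm q z (n - 2 * x.2)) =
      gaussTerm (q ^ 2) (z ^ 2) (n - x.1 - x.2) * airyKernel q x := by
    have h := gaussTerm_mul_gaussTerm hq0 hz (n - x.1 - x.2) (x.1 - x.2)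
    rw [show n - x.1 - x.2 + ((x.1 : ℤ) - x.2) = n - 2 * x.2 by ring,
      show n - x.1 - x.2 - ((x.1 : ℤ) - x.2) = n - 2 * x.1 by ring] at h
    rw [airyKernel]
    linear_combination airyCoeff q x.1 * airyCoeff q x.2 * h
  rw [sq (tsum _), tsum_mul_tsum_of_summable_norm hn.norm hn.norm]
  refine (summable_mul_of_summable_norm hn.norm hn.norm).hasSum.congr_fun fun x => ?_
  exact (hterm x).symm

lemma phi_eq (q : ℝ) (hq0 : q ≠ 0) (hz : z ≠ 0) (n : ℤ) :
    phi q z n = qpInf (q : ℂ) (-1) *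
      ∑' k : ℕ, airyCoeff (q : ℂ) k * gaussTerm (q : ℂ) z (n - 2 * k) := by
  have hQ : (q : ℂ) ≠ 0 := by exact_mod_cast hq0
  rw [phi, mul_assoc, mul_assoc, ← mul_assoc (z ^ n), ← tsum_mul_left]
  congr 1
  refine tsum_congr fun k => ?_
  have hk : ((2 * (k * (k - 1)) : ℕ) : ℤ) = 2 * (k * (k - 1)) := by
    cases k <;> simp
  have hexp : (n - 2 * k) * (n - 2 * k - 1) / 2 + k =
      n * (n - 1) / 2 + 2 * (k * (k - 1)) + (-2 * n + 4) * k := by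
    obtain ⟨a, ha⟩ := even_iff_two_dvd.mp (Int.even_mul_pred_self (n - 2 * k))
    obtain ⟨b, hb⟩ := even_iff_two_dvd.mp (Int.even_mul_pred_self n)
    rw [ha, hb]
    simp only [Int.mul_ediv_cancel_left _ (two_ne_zero : (2 : ℤ) ≠ 0)]
    have : 2 * (a + k) = 2 * (b + 2 * (k * (k - 1)) + (-2 * n + 4) * k) := by
      linear_combination hb - ha
    linarith
  have e : (q : ℂ) ^ ((n - 2 * k) * (n - 2 * k - 1) / 2) * (q : ℂ) ^ k =
      (q : ℂ) ^ (n * (n - 1) / 2) * (q : ℂ) ^ (2 * (k * (k - 1))) *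
        ((q : ℂ) ^ (-2 * n + 4)) ^ k := by
    rw [← zpow_natCast _ k, ← zpow_natCast _ k, ← zpow_natCast _ (2 * (k * (k - 1))), hk,
      ← zpow_mul, ← zpow_add₀ hQ, ← zpow_add₀ hQ, ← zpow_add₀ hQ, hexp]
  have e' : z ^ (n - 2 * (k : ℤ)) = z ^ n * (z ^ (-2 : ℤ)) ^ k := by
    rw [sub_eq_add_neg, zpow_add₀ hz, ← neg_mul, zpow_mul, zpow_natCast]
  simp only [airyCoeff, gaussTerm]
  rw [e', neg_pow, mul_pow, neg_pow ((q : ℂ) ^ (-2 * n + 4))]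
  linear_combination -(-1) ^ k * z ^ n * (z ^ (-2 : ℤ)) ^ k /
    qp ((q : ℂ) ^ 2) ((q : ℂ) ^ 2) k * e

end SumOfSquares

theorem stmt_4 (q : ℝ) (hq0 : 0 < q) (hq1 : q < 1) (z : ℂ) (hz : z ≠ 0) :
    HasSum (fun n : ℤ => (phi q z n) ^ 2)
      (4 * (qpInf ((q : ℂ) ^ 2) ((q : ℂ) ^ 2) ^ 2 / qpInf ((q : ℂ) ^ 2) (q : ℂ) ^ 2) *
        theta ((q : ℂ) ^ 2) (-z ^ 2)) := by
  have hQ : (q : ℂ) ≠ 0 := by exact_mod_cast hq0.ne'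
  have hQ1 : ‖(q : ℂ)‖ < 1 := by
    rw [Complex.norm_real, Real.norm_of_nonneg hq0.le]; exact hq1
  have h := (hasSum_sq_tsum_airyCoeff_mul_gaussTerm hQ hQ1 hz).mul_left (qpInf (q : ℂ) (-1) ^ 2)
  rw [jacobi_triple_product (pow_ne_zero 2 hQ) (norm_sq_lt_one hQ1) (pow_ne_zero 2 hz)] at h
  simp only [phi_eq q hq0.ne' hz, mul_pow]
  rw [qpInf_neg_one hQ1] at h ⊢
  have hval : (2 / qpInf ((q : ℂ) ^ 2) q) ^ 2 *
      (qpInf ((q : ℂ) ^ 2) ((q : ℂ) ^ 2) * qpInf ((q : ℂ) ^ 2) (-z ^ 2) *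
        qpInf ((q : ℂ) ^ 2) (-((q : ℂ) ^ 2 / z ^ 2)) * qpInf ((q : ℂ) ^ 2) ((q : ℂ) ^ 2)) =
      4 * (qpInf ((q : ℂ) ^ 2) ((q : ℂ) ^ 2) ^ 2 / qpInf ((q : ℂ) ^ 2) (q : ℂ) ^ 2) *
        theta ((q : ℂ) ^ 2) (-z ^ 2) := by
    rw [theta, div_neg]
    ring
  rwa [hval] at h
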